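/- Let H and H₁ be complex Hilbert spaces, let p > 0 and C₀ ≥ 0, and let B be a compact linear operator from H to H₁. Suppose that for each M ∈ ℕ there is a decomposition B = B_M + B'_M into compact operators such that s_j(B_M)·j^{1/p} → C_M as j → ∞ and s_j(B'_M)·j^{1/p} ≤ c_M for all j ≥ 1, where the constants satisfy C_M → C₀ and c_M → 0 as M → ∞. Then s_j(B)·j^{1/p} → C₀ as j → ∞. -/

import Mathlib

open Filter

/-- The `j`-th singular value (`s`-number / approximation number) of a compact
operator between Hilbert spaces: the distance from `B` to the operators of rank
`< j`. -/
noncomputable def sNum {H H₁ : Type*} [NormedAddCommGroup H] [NormedSpace ℂ H]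
    [NormedAddCommGroup H₁] [NormedSpace ℂ H₁] (B : H →L[ℂ] H₁) (j : ℕ) : ℝ :=
  sInf {c : ℝ | ∃ F : H →L[ℂ] H₁,
    FiniteDimensional ℂ (LinearMap.range (F : H →ₗ[ℂ] H₁)) ∧
    Module.finrank ℂ (LinearMap.range (F : H →ₗ[ℂ] H₁)) < j ∧ c = ‖B - F‖}

lemma sNum_bdd {H H₁ : Type*} [NormedAddCommGroup H] [NormedSpace ℂ H]
    [NormedAddCommGroup H₁] [NormedSpace ℂ H₁] (B : H →L[ℂ] H₁) (j : ℕ) :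
    BddBelow {c : ℝ | ∃ F : H →L[ℂ] H₁,
    FiniteDimensional ℂ (LinearMap.range (F : H →ₗ[ℂ] H₁)) ∧
    Module.finrank ℂ (LinearMap.range (F : H →ₗ[ℂ] H₁)) < j ∧ c = ‖B - F‖} := by
  refine ⟨0, ?_⟩
  rintro c ⟨F, -, -, rfl⟩
  exact norm_nonneg _

lemma sNum_approx {H H₁ : Type*} [NormedAddCommGroup H] [NormedSpace ℂ H]
    [NormedAddCommGroup H₁] [NormedSpace ℂ H₁] (B : H →L[ℂ] H₁) (j : ℕ) (hj : 1 ≤ j)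
    (ε : ℝ) (hε : 0 < ε) : ∃ F : H →L[ℂ] H₁,
    FiniteDimensional ℂ (LinearMap.range (F : H →ₗ[ℂ] H₁)) ∧
    Module.finrank ℂ (LinearMap.range (F : H →ₗ[ℂ] H₁)) < j ∧ ‖B - F‖ < sNum B j + ε := by
  have hne : {c : ℝ | ∃ F : H →L[ℂ] H₁,
    FiniteDimensional ℂ (LinearMap.range (F : H →ₗ[ℂ] H₁)) ∧
    Module.finrank ℂ (LinearMap.range (F : H →ₗ[ℂ] H₁)) < j ∧ c = ‖B - F‖}.Nonempty := by
    have h0 : LinearMap.range ((0 : H →L[ℂ] H₁) : H →ₗ[ℂ] H₁) = ⊥ := by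
      simp
    refine ⟨‖B - 0‖, 0, ?_, ?_, rfl⟩
    · rw [h0]; infer_instance
    · rw [h0, finrank_bot]; omega
  obtain ⟨c, ⟨F, h1, h2, rfl⟩, hc⟩ := exists_lt_of_csInf_lt hne
    (show sInf _ < sNum B j + ε by unfold sNum; linarith)
  exact ⟨F, h1, h2, hc⟩

lemma sNum_add_le {H H₁ : Type*} [NormedAddCommGroup H] [NormedSpace ℂ H]
    [NormedAddCommGroup H₁] [NormedSpace ℂ H₁] (A B : H →L[ℂ] H₁) (m n : ℕ)
    (hm : 1 ≤ m) (hn : 1 ≤ n) : sNum (A + B) (m + n) ≤ sNum A m + sNum B n := by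
  refine le_of_forall_pos_le_add fun ε hε => ?_
  obtain ⟨F, f1, f2, f3⟩ := sNum_approx A m hm (ε / 2) (by positivity)
  obtain ⟨G, g1, g2, g3⟩ := sNum_approx B n hn (ε / 2) (by positivity)
  have hle : LinearMap.range ((F + G : H →L[ℂ] H₁) : H →ₗ[ℂ] H₁) ≤
      LinearMap.range (F : H →ₗ[ℂ] H₁) ⊔ LinearMap.range (G : H →ₗ[ℂ] H₁) := by
    rintro _ ⟨x, rfl⟩
    exact Submodule.add_mem_sup ⟨x, rfl⟩ ⟨x, rfl⟩
  have hfr := Submodule.finrank_mono hle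
  have hfr2 := Submodule.finrank_add_le_finrank_add_finrank
    (LinearMap.range (F : H →ₗ[ℂ] H₁)) (LinearMap.range (G : H →ₗ[ℂ] H₁))
  have key : sNum (A + B) (m + n) ≤ ‖(A + B) - (F + G)‖ := by
    refine csInf_le (sNum_bdd _ _) ⟨F + G, ?_, by omega, rfl⟩
    exact Submodule.finiteDimensional_of_le hle
  have : ‖(A + B) - (F + G)‖ ≤ ‖A - F‖ + ‖B - G‖ := by
    rw [add_sub_add_comm]; exact norm_add_le _ _
  linarith

lemma sNum_neg_le {H H₁ : Type*} [NormedAddCommGroup H] [NormedSpace ℂ H]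
    [NormedAddCommGroup H₁] [NormedSpace ℂ H₁] (B : H →L[ℂ] H₁) (n : ℕ)
    (hn : 1 ≤ n) : sNum (-B) n ≤ sNum B n := by
  refine le_of_forall_pos_le_add fun ε hε => ?_
  obtain ⟨F, f1, f2, f3⟩ := sNum_approx B n hn ε hε
  have hr : LinearMap.range ((-F : H →L[ℂ] H₁) : H →ₗ[ℂ] H₁) =
      LinearMap.range (F : H →ₗ[ℂ] H₁) := by
    ext y; constructor
    · rintro ⟨x, rfl⟩; exact ⟨-x, by simp⟩
    · rintro ⟨x, rfl⟩; exact ⟨-x, by simp⟩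
  have key : sNum (-B) n ≤ ‖-B - -F‖ := by
    refine csInf_le (sNum_bdd _ _) ⟨-F, ?_, ?_, rfl⟩
    · rw [hr]; exact f1
    · rw [hr]; exact f2
  have : ‖-B - -F‖ = ‖B - F‖ := by
    rw [← norm_neg]; congr 1; abel
  linarith

lemma rescale_eq (a : ℝ) (j n : ℕ) (hj : 1 ≤ j) (hn : 1 ≤ n) :
    (j : ℝ) ^ a = (n : ℝ) ^ a * ((n : ℝ) / j) ^ (-a) := by
  have hj' : (0 : ℝ) < j := by exact_mod_cast hj
  have hn' : (0 : ℝ) < n := by exact_mod_cast hn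
  rw [Real.rpow_neg (by positivity), Real.div_rpow hn'.le hj'.le, inv_div]
  have := (Real.rpow_pos_of_pos hn' a).ne'
  field_simp

lemma rescale_tendsto (a C r : ℝ) (hr : 0 < r) (f : ℕ → ℝ) (u : ℕ → ℕ)
    (hu : Tendsto u atTop atTop) (hur : Tendsto (fun j : ℕ => (u j : ℝ) / j) atTop (nhds r))
    (hf : Tendsto (fun j : ℕ => f j * (j : ℝ) ^ a) atTop (nhds C)) :
    Tendsto (fun j : ℕ => f (u j) * (j : ℝ) ^ a) atTop (nhds (C * r ^ (-a))) := by
  have h := (hf.comp hu).mul (hur.rpow_const (p := -a) (Or.inl hr.ne'))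
  refine h.congr' ?_
  filter_upwards [eventually_ge_atTop 1, hu.eventually_ge_atTop 1] with j hj hn
  simp only [Function.comp]
  rw [rescale_eq a j (u j) hj hn, mul_assoc]

/-- Lemma 4.1, 2° (refined perturbation rule): if `B = B_M + B'_M` for each `M`,
with `s_j(B_M)·j^{1/p} → C_M` as `j → ∞`, `s_j(B'_M)·j^{1/p} ≤ c_M` for all `j ≥ 1`,
`C_M → C₀` and `c_M → 0`, then `s_j(B)·j^{1/p} → C₀`. -/
theorem stmt4 {H H₁ : Type*}
    [NormedAddCommGroup H] [InnerProductSpace ℂ H] [CompleteSpace H]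
    [NormedAddCommGroup H₁] [InnerProductSpace ℂ H₁] [CompleteSpace H₁]
    (p C₀ : ℝ) (hp : 0 < p) (hC₀ : 0 ≤ C₀)
    (B : H →L[ℂ] H₁) (hB : IsCompactOperator (⇑B))
    (BM B'M : ℕ → (H →L[ℂ] H₁))
    (hBM : ∀ M, IsCompactOperator (⇑(BM M)))
    (hB'M : ∀ M, IsCompactOperator (⇑(B'M M)))
    (hdec : ∀ M, B = BM M + B'M M)
    (CM cM : ℕ → ℝ)
    (h1 : ∀ M, Tendsto (fun j : ℕ => sNum (BM M) j * (j : ℝ) ^ (1 / p)) atTop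
      (nhds (CM M)))
    (h2 : ∀ M, ∀ j : ℕ, 1 ≤ j → sNum (B'M M) j * (j : ℝ) ^ (1 / p) ≤ cM M)
    (hCM : Tendsto CM atTop (nhds C₀))
    (hcM : Tendsto cM atTop (nhds 0)) :
    Tendsto (fun j : ℕ => sNum B j * (j : ℝ) ^ (1 / p)) atTop (nhds C₀) := by
  set a := 1 / p with ha
  -- the splitting index
  have hfl : ∀ δ : ℝ, 0 < δ →
      Tendsto (fun j : ℕ => ((⌊δ * (j : ℝ)⌋₊ : ℕ) : ℝ) / j) atTop (nhds δ) := fun δ hδ =>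
    (tendsto_nat_floor_mul_div_atTop hδ.le).comp tendsto_natCast_atTop_atTop
  have hfi : ∀ δ : ℝ, 0 < δ → Tendsto (fun j : ℕ => ⌊δ * (j : ℝ)⌋₊) atTop atTop := fun δ hδ =>
    tendsto_nat_floor_atTop.comp (tendsto_natCast_atTop_atTop.const_mul_atTop hδ)
  have hsmall : ∀ δ : ℝ, 0 < δ → ∀ M, ∀ᶠ j : ℕ in atTop,
      sNum (B'M M) ⌊δ * (j : ℝ)⌋₊ * (j : ℝ) ^ a ≤
        cM M * (((⌊δ * (j : ℝ)⌋₊ : ℕ) : ℝ) / j) ^ (-a) := by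
    intro δ hδ M
    filter_upwards [eventually_ge_atTop 1, (hfi δ hδ).eventually_ge_atTop 1] with j hj hn
    rw [rescale_eq a j _ hj hn, ← mul_assoc]
    exact mul_le_mul_of_nonneg_right (h2 M _ hn) (by positivity)
  have hsl : ∀ δ : ℝ, 0 < δ → ∀ M, Tendsto (fun j : ℕ =>
      cM M * (((⌊δ * (j : ℝ)⌋₊ : ℕ) : ℝ) / j) ^ (-a)) atTop (nhds (cM M * δ ^ (-a))) :=
    fun δ hδ M => ((hfl δ hδ).rpow_const (Or.inl hδ.ne')).const_mul _
  rw [tendsto_order]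
  constructor
  · intro b hb
    have hcont : Tendsto (fun δ : ℝ => C₀ * (1 + δ) ^ (-a)) (nhdsWithin 0 (Set.Ioi 0))
        (nhds (C₀ * (1 + 0) ^ (-a))) := by
      refine Tendsto.mono_left ?_ nhdsWithin_le_nhds
      exact ((tendsto_const_nhds.add tendsto_id).rpow_const (Or.inl (by norm_num))).const_mul _
    simp only [add_zero, Real.one_rpow, mul_one] at hcont
    obtain ⟨δ, hδb, hδ⟩ := ((hcont.eventually_const_lt hb).and self_mem_nhdsWithin).exists
    have hδ : 0 < δ := hδ
    have hM : Tendsto (fun M => CM M * (1 + δ) ^ (-a) - cM M * δ ^ (-a)) atTop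
        (nhds (C₀ * (1 + δ) ^ (-a) - 0 * δ ^ (-a))) :=
      (hCM.mul_const _).sub (hcM.mul_const _)
    rw [zero_mul, sub_zero] at hM
    obtain ⟨M, hM⟩ := (hM.eventually_const_lt hδb).exists
    have hu : Tendsto (fun j : ℕ => j + ⌊δ * (j : ℝ)⌋₊) atTop atTop :=
      tendsto_atTop_mono (fun j => Nat.le_add_right _ _) tendsto_id
    have hur : Tendsto (fun j : ℕ => ((j + ⌊δ * (j : ℝ)⌋₊ : ℕ) : ℝ) / j) atTop
        (nhds (1 + δ)) := by
      refine ((hfl δ hδ).const_add 1).congr' ?_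
      filter_upwards [eventually_ge_atTop 1] with j hj
      have hj' : (0 : ℝ) < j := by exact_mod_cast hj
      push_cast
      field_simp
    have hl := (rescale_tendsto a (CM M) (1 + δ) (by linarith) _ _ hu hur (h1 M)).sub
      (hsl δ hδ M)
    filter_upwards [hl.eventually_const_lt hM, hsmall δ hδ M, eventually_ge_atTop 1,
      (hfi δ hδ).eventually_ge_atTop 1] with j e1 e2 hj hn
    have e3 := sNum_add_le B (-(B'M M)) j _ hj hn
    have e4 := sNum_neg_le (B'M M) _ hn
    have e5 : B + -(B'M M) = BM M := by rw [hdec M]; abel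
    rw [e5] at e3
    have e6 := mul_le_mul_of_nonneg_right (e3.trans (add_le_add_right e4 _))
      (show (0 : ℝ) ≤ (j : ℝ) ^ a by positivity)
    rw [add_mul] at e6
    linarith
  · intro b hb
    have hcont : Tendsto (fun δ : ℝ => C₀ * (1 - δ) ^ (-a)) (nhdsWithin 0 (Set.Ioi 0))
        (nhds (C₀ * (1 - 0) ^ (-a))) := by
      refine Tendsto.mono_left ?_ nhdsWithin_le_nhds
      exact ((tendsto_const_nhds.sub tendsto_id).rpow_const (Or.inl (by norm_num))).const_mul _
    simp only [sub_zero, Real.one_rpow, mul_one] at hcont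
    obtain ⟨δ, hδb, hδ, hδ1⟩ := ((hcont.eventually_lt_const hb).and
      (Ioo_mem_nhdsGT (show (0 : ℝ) < 1 by norm_num))).exists
    have hM : Tendsto (fun M => CM M * (1 - δ) ^ (-a) + cM M * δ ^ (-a)) atTop
        (nhds (C₀ * (1 - δ) ^ (-a) + 0 * δ ^ (-a))) :=
      (hCM.mul_const _).add (hcM.mul_const _)
    rw [zero_mul, add_zero] at hM
    obtain ⟨M, hM⟩ := (hM.eventually_lt_const hδb).exists
    have hle : ∀ j : ℕ, ⌊δ * (j : ℝ)⌋₊ ≤ j := fun j => by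
      refine Nat.floor_le_of_le ?_
      exact mul_le_of_le_one_left (Nat.cast_nonneg j) hδ1.le
    have hur : Tendsto (fun j : ℕ => ((j - ⌊δ * (j : ℝ)⌋₊ : ℕ) : ℝ) / j) atTop
        (nhds (1 - δ)) := by
      refine ((hfl δ hδ).const_sub 1).congr' ?_
      filter_upwards [eventually_ge_atTop 1] with j hj
      have hj' : (0 : ℝ) < j := by exact_mod_cast hj
      rw [Nat.cast_sub (hle j)]
      field_simp
    have hu : Tendsto (fun j : ℕ => j - ⌊δ * (j : ℝ)⌋₊) atTop atTop := by
      rw [← tendsto_natCast_atTop_iff (R := ℝ)]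
      have := hur.pos_mul_atTop (by linarith) (tendsto_natCast_atTop_atTop (R := ℝ))
      refine this.congr' ?_
      filter_upwards [eventually_ge_atTop 1] with j hj
      have hj' : (0 : ℝ) < j := by exact_mod_cast hj
      field_simp
    have hl := (rescale_tendsto a (CM M) (1 - δ) (by linarith) _ _ hu hur (h1 M)).add
      (hsl δ hδ M)
    filter_upwards [hl.eventually_lt_const hM, hsmall δ hδ M, hu.eventually_ge_atTop 1,
      (hfi δ hδ).eventually_ge_atTop 1] with j e1 e2 hj hn
    have e3 := sNum_add_le (BM M) (B'M M) _ _ hj hn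
    rw [← hdec M, Nat.sub_add_cancel (hle j)] at e3
    have e6 := mul_le_mul_of_nonneg_right e3 (show (0 : ℝ) ≤ (j : ℝ) ^ a by positivity)
    rw [add_mul] at e6
    linarith
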